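/- arXiv:1804.04174 — 3 statements merged into one kernel-verified Lean document; each statement's English description precedes it below -/
import Mathlib

section
/- (Equivalence of ILBFP and ILBFP-Compact.) Assume the set S_c = {(x, λ) | x ∈ Δ, λ ≥ q·x for all q ∈ Ω, and ∑ t, π t * y t (x, λ) ≥ μ0} is nonempty. Then the optimal value of the investor-leader broker-dealer-follower problem, namely sup { C(x, p·x) | x ∈ Δ, p ∈ Ω, p·x = max over q ∈ Ω of q·x, and ∑ t, π t * y t (x, p·x) ≥ μ0 }, is equal to sup { C(x, λ) | (x, λ) ∈ S_c }. -/
/-- The Rockafellar-Uryasev objective of a discrete distribution is bounded above by its mean. -/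
theorem cvar_objective_le_mean {ι : Type*} [Fintype ι] {w : ι → ℝ} (hw : ∀ i, 0 ≤ w i)
    (hsum : ∑ i, w i = 1) {α : ℝ} (hα0 : 0 < α) (hα1 : α ≤ 1) (u : ι → ℝ) (η : ℝ) :
    η - (1 / α) * ∑ i, w i * max 0 (η - u i) ≤ ∑ i, w i * u i := by
  have hα : 1 ≤ 1 / α := (one_le_div hα0).2 hα1
  have hnonneg : 0 ≤ ∑ i, w i * max 0 (η - u i) :=
    Finset.sum_nonneg fun i _ => mul_nonneg (hw i) (le_max_left _ _)
  have hle : ∑ i, w i * (η - u i) ≤ ∑ i, w i * max 0 (η - u i) :=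
    Finset.sum_le_sum fun i _ => mul_le_mul_of_nonneg_left (le_max_right _ _) (hw i)
  have heq : ∑ i, w i * (η - u i) = η - ∑ i, w i * u i := by
    simp only [mul_sub, Finset.sum_sub_distrib, ← Finset.sum_mul, hsum, one_mul]
  linarith [le_mul_of_one_le_left hnonneg hα]

/-- The discrete CVaR is monotone in the outcomes. -/
theorem cvar_mono {ι : Type*} [Fintype ι] {w : ι → ℝ} (hw : ∀ i, 0 ≤ w i)
    (hsum : ∑ i, w i = 1) {α : ℝ} (hα0 : 0 < α) (hα1 : α ≤ 1) {u v : ι → ℝ} (huv : u ≤ v) :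
    (⨆ η : ℝ, (η - (1 / α) * ∑ i, w i * max 0 (η - u i))) ≤
      ⨆ η : ℝ, (η - (1 / α) * ∑ i, w i * max 0 (η - v i)) := by
  refine ciSup_mono ⟨∑ i, w i * v i, ?_⟩ fun η => ?_
  · rintro _ ⟨η, rfl⟩
    exact cvar_objective_le_mean hw hsum hα0 hα1 v η
  · refine sub_le_sub_left (mul_le_mul_of_nonneg_left ?_ (one_div_pos.2 hα0).le) η
    exact Finset.sum_le_sum fun i _ => mul_le_mul_of_nonneg_left
      (max_le_max_left 0 (sub_le_sub_left (huv i) η)) (hw i)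

/-- Equivalence of ILBFP and ILBFP-Compact: assuming the feasible set of the compact
formulation is nonempty, the optimal value of the investor-leader broker-dealer-follower
problem (where the follower sets the costs `p ∈ Ω` maximizing `p·x`) equals the optimal
value of the compact formulation in the variables `(x, λ)` with `λ ≥ q·x` for all `q ∈ Ω`. -/
theorem ILBFP_equiv_compact
    (T n : ℕ) (hT : 1 ≤ T) (hn : 1 ≤ n)
    (π : Fin T → ℝ) (hπpos : ∀ t, 0 < π t) (hπsum : ∑ t, π t = 1)
    (α : ℝ) (hα0 : 0 < α) (hα1 : α ≤ 1)
    (r : Fin T → Fin n → ℝ) (μ0 : ℝ)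
    (Ω : Finset (Fin n → ℝ)) (hΩ : Ω.Nonempty) (hΩpos : ∀ p ∈ Ω, ∀ j, 0 ≤ p j)
    (Δ : Set (Fin n → ℝ))
    (hΔ : Δ = {x | (∀ j, 0 ≤ x j) ∧ (∑ j, x j) ≤ 1})
    (y : (Fin n → ℝ) → ℝ → Fin T → ℝ)
    (hy : ∀ x lam t, y x lam t = (∑ j, r t j * x j) - lam)
    (C : (Fin n → ℝ) → ℝ → ℝ)
    (hC : ∀ x lam, C x lam =
      ⨆ η : ℝ, (η - (1 / α) * ∑ t, π t * max 0 (η - y x lam t)))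
    (hSc : {xl : (Fin n → ℝ) × ℝ | xl.1 ∈ Δ ∧
        (∀ q ∈ Ω, (∑ j, q j * xl.1 j) ≤ xl.2) ∧
        (∑ t, π t * y xl.1 xl.2 t) ≥ μ0}.Nonempty) :
    sSup {v : ℝ | ∃ x ∈ Δ, ∃ p ∈ Ω,
        (∀ q ∈ Ω, (∑ j, q j * x j) ≤ ∑ j, p j * x j) ∧
        (∑ t, π t * y x (∑ j, p j * x j) t) ≥ μ0 ∧
        v = C x (∑ j, p j * x j)} =
      sSup {v : ℝ | ∃ xl : (Fin n → ℝ) × ℝ,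
        (xl.1 ∈ Δ ∧ (∀ q ∈ Ω, (∑ j, q j * xl.1 j) ≤ xl.2) ∧
          (∑ t, π t * y xl.1 xl.2 t) ≥ μ0) ∧
        v = C xl.1 xl.2} := by
  apply csSup_eq_csSup_of_forall_exists_le
  · rintro _ ⟨x, hx, p, _, hmax, hμ, rfl⟩
    exact ⟨_, ⟨(x, ∑ j, p j * x j), ⟨hx, hmax, hμ⟩, rfl⟩, le_rfl⟩
  · rintro _ ⟨⟨x, lam⟩, ⟨hx, hlam, hμ⟩, rfl⟩
    obtain ⟨p, hp, hmax⟩ := Ω.exists_max_image (fun q => ∑ j, q j * x j) hΩ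
    have hyle : y x lam ≤ y x (∑ j, p j * x j) := fun t => by
      rw [hy, hy]
      exact sub_le_sub_left (hlam p hp) _
    refine ⟨_, ⟨x, hx, p, hp, hmax, ?_, rfl⟩, ?_⟩
    · exact hμ.le.trans (Finset.sum_le_sum fun t _ =>
        mul_le_mul_of_nonneg_left (hyle t) (hπpos t).le)
    · rw [hC, hC]
      exact cvar_mono (fun t => (hπpos t).le) hπsum hα0 hα1 hyle
end

section
/- (LP dual representation of the CVaR used in the Benders decomposition.) The set Γ = {γ : Fin T → ℝ | −π t / α ≤ γ t ≤ 0 for all t, and ∑ t, γ t = −1} is nonempty and compact, the minimum of γ ↦ ∑ t, (−γ t) * y t over Γ is attained, and CVaR_α(y) = min over γ ∈ Γ of ∑ t, (−γ t) * y t. -/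
open Finset in
/-- Every finite distribution has an `α`-quantile among its values. -/
lemma exists_quantile {ι : Type*} [Fintype ι] (y p : ι → ℝ)
    (hp : ∀ t, 0 ≤ p t) (hsum : ∑ t, p t = 1) {α : ℝ} (hα0 : 0 ≤ α) (hα1 : α ≤ 1) :
    ∃ q : ℝ, ∑ t with y t < q, p t ≤ α ∧ α ≤ ∑ t with y t ≤ q, p t := by
  classical
  have hne : (univ : Finset ι).Nonempty := by
    by_contra h
    rw [not_nonempty_iff_eq_empty] at h
    simp [h] at hsum
  obtain ⟨m, -, hm⟩ := exists_max_image univ y hne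
  have hmem : m ∈ ({t | α ≤ ∑ s with y s ≤ y t, p s} : Finset ι) := by
    rw [mem_filter, filter_true_of_mem hm, hsum]
    exact ⟨mem_univ m, hα1⟩
  obtain ⟨t, ht, hmin⟩ := exists_min_image _ y ⟨m, hmem⟩
  refine ⟨y t, ?_, (mem_filter.mp ht).2⟩
  rcases ({s | y s < y t} : Finset ι).eq_empty_or_nonempty with h | h
  · simpa [h] using hα0
  · obtain ⟨s, hs, hmax⟩ := exists_max_image _ y h
    have hlt : ∑ r with y r ≤ y s, p r < α := by
      by_contra! hle
      exact (hmin s (by simpa using hle)).not_gt (mem_filter.mp hs).2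
    refine (sum_le_sum_of_subset_of_nonneg (fun r hr => ?_) fun r _ _ => hp r).trans hlt.le
    simpa using hmax r hr

/-- A number between `a` and `a + b` is reached by adding a fraction of `b` to `a`. -/
lemma exists_fraction {a b c : ℝ} (hac : a ≤ c) (hcb : c ≤ a + b) :
    ∃ l : ℝ, 0 ≤ l ∧ l ≤ 1 ∧ a + l * b = c := by
  rcases eq_or_ne b 0 with rfl | hb
  · exact ⟨0, le_rfl, zero_le_one, by linarith⟩
  · have hb' : 0 < b := lt_of_le_of_ne (by linarith) hb.symm
    exact ⟨(c - a) / b, div_nonneg (by linarith) hb'.le,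
      (div_le_one hb').2 (by linarith), by field_simp; ring⟩

/-- There are weights in the risk envelope that are complementary to a quantile `q`. -/
lemma exists_complementary_weights {ι : Type*} [Fintype ι] (y p : ι → ℝ)
    (hp : ∀ t, 0 ≤ p t) (hsum : ∑ t, p t = 1) {α : ℝ} (hα0 : 0 < α) (hα1 : α ≤ 1) :
    ∃ (q : ℝ) (w : ι → ℝ), (∀ t, 0 ≤ w t ∧ w t ≤ p t / α) ∧ ∑ t, w t = 1 ∧
      ∀ t, w t * (q - y t) = p t / α * max 0 (q - y t) := by
  obtain ⟨q, hlt, hle⟩ := exists_quantile y p hp hsum hα0.le hα1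
  have hsplit : ∑ t with y t ≤ q, p t = ∑ t with y t < q, p t + ∑ t with y t = q, p t := by
    simp only [Finset.sum_filter, ← Finset.sum_add_distrib]
    refine Finset.sum_congr rfl fun t _ => ?_
    rcases lt_trichotomy (y t) q with h | h | h
    · simp [h, h.le, h.ne]
    · simp [h]
    · simp [h.not_ge, h.not_gt, h.ne']
  obtain ⟨l, hl0, hl1, hl⟩ := exists_fraction hlt (hle.trans_eq hsplit)
  have hpα : ∀ t, 0 ≤ p t / α := fun t => div_nonneg (hp t) hα0.le
  refine ⟨q, fun t => p t / α * (if y t < q then 1 else if y t = q then l else 0),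
    fun t => ⟨?_, ?_⟩, ?_, fun t => ?_⟩
  · refine mul_nonneg (hpα t) ?_
    split_ifs <;> simp [hl0]
  · refine mul_le_of_le_one_right (hpα t) ?_
    split_ifs <;> simp [hl1]
  · rw [← mul_left_inj' hα0.ne', one_mul, Finset.sum_mul]
    refine Eq.trans ?_ hl
    rw [Finset.sum_filter, Finset.sum_filter, Finset.mul_sum, ← Finset.sum_add_distrib]
    refine Finset.sum_congr rfl fun t _ => ?_
    rcases lt_trichotomy (y t) q with h | h | h
    · simp [h, h.ne, hα0.ne']
    · simp [h]; field_simp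
    · simp [h.not_gt, h.ne']
  · rcases lt_trichotomy (y t) q with h | h | h
    · simp [h, max_eq_right (sub_nonneg.2 h.le)]
    · simp [h]
    · simp [h.not_gt, h.ne', max_eq_left (sub_nonpos.2 h.le)]

/-- LP dual representation of the CVaR used in the Benders decomposition:
the polytope `Γ = {γ | -π t / α ≤ γ t ≤ 0, ∑ t, γ t = -1}` is nonempty and compact,
the minimum of `γ ↦ ∑ t, (-γ t) * y t` over `Γ` is attained, and it equals
`CVaR_α(y) = ⨆ η, η - (1/α) * ∑ t, π t * max 0 (η - y t)`. -/
theorem cvar_lp_dual_representation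
    (T : ℕ) (hT : 1 ≤ T) (y : Fin T → ℝ) (π : Fin T → ℝ)
    (hπ : ∀ t, 0 ≤ π t) (hπsum : ∑ t, π t = 1)
    (α : ℝ) (hα0 : 0 < α) (hα1 : α ≤ 1)
    (Γ : Set (Fin T → ℝ))
    (hΓ : Γ = {γ | (∀ t, -π t / α ≤ γ t ∧ γ t ≤ 0) ∧ ∑ t, γ t = -1}) :
    Γ.Nonempty ∧ IsCompact Γ ∧
      ∃ γ ∈ Γ, (∀ γ' ∈ Γ, ∑ t, (-γ t) * y t ≤ ∑ t, (-γ' t) * y t) ∧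
        (⨆ η : ℝ, η - (1 / α) * ∑ t, π t * max 0 (η - y t)) = ∑ t, (-γ t) * y t := by
  subst hΓ
  obtain ⟨q, w, hw, hwsum, hwq⟩ := exists_complementary_weights y π hπ hπsum hα0 hα1
  have hφ : ∀ η, (1 / α) * ∑ t, π t * max 0 (η - y t) = ∑ t, π t / α * max 0 (η - y t) := by
    intro η
    rw [Finset.mul_sum]
    exact Finset.sum_congr rfl fun t _ => by ring
  have hval : ∀ γ : Fin T → ℝ, ∑ t, γ t = -1 → ∀ η,
      ∑ t, (-γ t) * y t = η - ∑ t, (-γ t) * (η - y t) := by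
    intro γ hγ η
    simp only [mul_sub, Finset.sum_sub_distrib, ← Finset.sum_mul, Finset.sum_neg_distrib, hγ]
    ring
  set Γ : Set (Fin T → ℝ) := {γ | (∀ t, -π t / α ≤ γ t ∧ γ t ≤ 0) ∧ ∑ t, γ t = -1}
  have hweak : ∀ γ ∈ Γ, ∀ η,
      η - (1 / α) * ∑ t, π t * max 0 (η - y t) ≤ ∑ t, (-γ t) * y t := by
    rintro γ ⟨hγ, hγsum⟩ η
    rw [hval γ hγsum η, hφ]
    refine sub_le_sub_left (Finset.sum_le_sum fun t _ => ?_) η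
    have h0 : 0 ≤ -γ t := neg_nonneg.2 (hγ t).2
    have h1 : -γ t ≤ π t / α := by linarith [(hγ t).1, neg_div α (π t)]
    exact (mul_le_mul_of_nonneg_left (le_max_right 0 _) h0).trans
      (mul_le_mul_of_nonneg_right h1 (le_max_left 0 _))
  have hmem : (fun t => -w t) ∈ Γ :=
    ⟨fun t => ⟨by rw [neg_div]; exact neg_le_neg (hw t).2, neg_nonpos.2 (hw t).1⟩,
      by rw [Finset.sum_neg_distrib, hwsum]⟩
  have heq : ∑ t, (-(-w t)) * y t = q - (1 / α) * ∑ t, π t * max 0 (q - y t) := by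
    rw [hval _ hmem.2 q, hφ]
    simp only [neg_neg, hwq]
  refine ⟨⟨_, hmem⟩, ?_, _, hmem, fun γ hγ => heq.trans_le (hweak γ hγ q), ?_⟩
  · refine (isCompact_Icc (a := fun t => -π t / α) (b := 0)).of_isClosed_subset ?_
      fun γ hγ => ⟨fun t => (hγ.1 t).1, fun t => (hγ.1 t).2⟩
    simp only [Γ, Set.ofPred_and, Set.ofPred_forall]
    exact (isClosed_iInter fun t => (isClosed_le (by fun_prop) (by fun_prop)).inter
      (isClosed_le (by fun_prop) (by fun_prop))).inter (isClosed_eq (by fun_prop) (by fun_prop))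
  · refine le_antisymm (ciSup_le (hweak _ hmem)) (heq.trans_le ?_)
    exact le_ciSup (f := fun η => η - (1 / α) * ∑ t, π t * max 0 (η - y t))
      ⟨_, Set.forall_mem_range.2 (hweak _ hmem)⟩ q
end

section
/- (Attainment of the CVaR at a scenario value; no recession directions in the CVaR problem.) There exists a scenario index t* such that φ(y t*) = CVaR_α(y); that is, the supremum defining the Conditional Value-at-Risk is attained at some η belonging to the finite set of scenario return values {y 1, …, y T}. -/
/-- If no scenario value separates `x` from `η`, the Rockafellar–Uryasev function is affine
between them, with slope determined by the probability of a return below `η`. -/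
theorem rockafellarUryasev_sub_eq {ι : Type*} [Fintype ι] (y π : ι → ℝ) (α η x : ℝ)
    (hlt : ∀ t, y t < η → y t ≤ x) (hge : ∀ t, η ≤ y t → x ≤ y t) :
    (x - (1 / α) * ∑ t, π t * max 0 (x - y t)) - (η - (1 / α) * ∑ t, π t * max 0 (η - y t)) =
      (1 - (1 / α) * ∑ t with y t < η, π t) * (x - η) := by
  have h : ∑ t, π t * max 0 (x - y t) =
      ∑ t, π t * max 0 (η - y t) + (∑ t with y t < η, π t) * (x - η) := by
    rw [Finset.sum_filter, Finset.sum_mul, ← Finset.sum_add_distrib]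
    refine Finset.sum_congr rfl fun t _ => ?_
    split_ifs with ht
    · rw [max_eq_right (by linarith [hlt t ht]), max_eq_right (by linarith)]
      ring
    · have ht' := not_lt.mp ht
      rw [max_eq_left (by linarith [hge t ht']), max_eq_left (by linarith)]
      ring
  rw [h]
  ring

/-- The Rockafellar–Uryasev function at any point is at most its value at some scenario. -/
theorem exists_rockafellarUryasev_le {ι : Type*} [Fintype ι] [Nonempty ι] (y π : ι → ℝ)
    (hπsum : ∑ t, π t = 1) (α : ℝ) (hα0 : 0 < α) (hα1 : α ≤ 1) (η : ℝ) :
    ∃ s, η - (1 / α) * ∑ t, π t * max 0 (η - y t) ≤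
      y s - (1 / α) * ∑ t, π t * max 0 (y s - y t) := by
  by_cases hdown : 1 - (1 / α) * ∑ t with y t < η, π t ≤ 0 ∧ ∃ t, y t < η
  · obtain ⟨hc, t₀, ht₀⟩ := hdown
    obtain ⟨s, hs, hmax⟩ := Finset.exists_max_image (Finset.univ.filter (y · < η)) y
      ⟨t₀, by simpa using ht₀⟩
    simp only [Finset.mem_filter_univ] at hs hmax
    refine ⟨s, ?_⟩
    have h := rockafellarUryasev_sub_eq y π α η (y s) hmax fun t ht => by linarith
    have := mul_nonneg_of_nonpos_of_nonpos hc (sub_nonpos.mpr hs.le)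
    linarith
  · have hup : ∃ t, η ≤ y t := by
      by_contra! hall
      refine hdown ⟨?_, Classical.arbitrary ι, hall _⟩
      simp only [hall, Finset.filter_true, hπsum]
      linarith [(one_le_div hα0).mpr hα1]
    have hc : 0 ≤ 1 - (1 / α) * ∑ t with y t < η, π t := by
      by_contra! hneg
      refine hdown ⟨hneg.le, ?_⟩
      by_contra! hall
      simp only [not_lt.mpr (hall _), Finset.filter_false, Finset.sum_empty] at hneg
      linarith
    obtain ⟨t₀, ht₀⟩ := hup
    obtain ⟨s, hs, hmin⟩ := Finset.exists_min_image (Finset.univ.filter (η ≤ y ·)) y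
      ⟨t₀, by simpa using ht₀⟩
    simp only [Finset.mem_filter_univ] at hs hmin
    refine ⟨s, ?_⟩
    have h := rockafellarUryasev_sub_eq y π α η (y s) (fun t ht => by linarith) hmin
    have := mul_nonneg hc (sub_nonneg.mpr hs)
    linarith

/-- Attainment of the CVaR at a scenario value: there exists a scenario index `t*`
such that `φ (y t*) = CVaR_α(y)`, i.e. the supremum defining the CVaR is attained at
some `η` in the finite set of scenario return values. -/
theorem cvar_attained_at_scenario_value
    (T : ℕ) (hT : 1 ≤ T) (y : Fin T → ℝ) (π : Fin T → ℝ)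
    (hπ : ∀ t, 0 ≤ π t) (hπsum : ∑ t, π t = 1)
    (α : ℝ) (hα0 : 0 < α) (hα1 : α ≤ 1) :
    ∃ tstar : Fin T,
      (y tstar - (1 / α) * ∑ t, π t * max 0 (y tstar - y t)) =
        ⨆ η : ℝ, η - (1 / α) * ∑ t, π t * max 0 (η - y t) := by
  have : Nonempty (Fin T) := ⟨⟨0, hT⟩⟩
  obtain ⟨s, hs⟩ := Finite.exists_max
    fun s : Fin T => y s - (1 / α) * ∑ t, π t * max 0 (y s - y t)
  have hle : ∀ η : ℝ, η - (1 / α) * ∑ t, π t * max 0 (η - y t) ≤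
      y s - (1 / α) * ∑ t, π t * max 0 (y s - y t) := fun η =>
    let ⟨r, hr⟩ := exists_rockafellarUryasev_le y π hπsum α hα0 hα1 η
    hr.trans (hs r)
  exact ⟨s, le_antisymm
    (le_ciSup (f := fun η : ℝ => η - (1 / α) * ∑ t, π t * max 0 (η - y t))
      ⟨_, Set.forall_mem_range.mpr hle⟩ (y s))
    (ciSup_le hle)⟩
end
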